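/- Let (L, (A_b)_{0≤b<B}, C) be a zero-insensitive linear representation (i.e. L·A_0 = L) of the sequence u_n = s_n − s_{n−1} of backward differences of a sequence s. Define Σ_K(x) = Σ_{|w|=K, .w ≤ x} A_w C, summing over words w of length K whose value as a B-ary fraction 0.w is at most x, and S_K(x) = L·Σ_K(x). Then for N ≥ 1, writing K = ⌊log_B N⌋ and t = log_B N − K, one has s_N = S_{K+1}(B^{t−1}). -/

import Mathlib

open Matrix

theorem ofFn_rev {α : Type*} {M : ℕ} (f : Fin M → α) :
    (List.ofFn fun i => f i.rev) = (List.ofFn f).reverse := by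
  refine List.ext_getElem (by simp) fun i _ _ => ?_
  simp [Fin.rev, Nat.sub_sub, Nat.add_comm]

theorem ofDigits_ofFn_eq_sum (B : ℕ) {M : ℕ} (f : Fin M → ℕ) :
    Nat.ofDigits B (List.ofFn f) = ∑ i, f i * B ^ (i : ℕ) := by
  induction M with
  | zero => simp
  | succ M ih =>
    rw [List.ofFn_succ, Nat.ofDigits_cons, ih, Fin.sum_univ_succ, Finset.mul_sum]
    simp [pow_succ', mul_left_comm]

/-- Leading zeros do not matter in a zero-insensitive linear representation. -/
theorem vecMul_prod_eq_vecMul_prod_digits {R : Type*} [CommSemiring R] {B d : ℕ} (hB : 1 < B)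
    {L : Fin d → R} {A : ℕ → Matrix (Fin d) (Fin d) R} (hzero : L ᵥ* A 0 = L)
    (l : List ℕ) (hl : ∀ a ∈ l, a < B) :
    L ᵥ* (l.reverse.map A).prod =
      L ᵥ* ((Nat.digits B (Nat.ofDigits B l)).reverse.map A).prod := by
  induction l with
  | nil => simp
  | cons a l ih =>
    have ih := ih fun b hb => hl b (List.mem_cons_of_mem _ hb)
    rw [Nat.ofDigits_cons, List.reverse_cons, List.map_append, List.prod_append,
      ← vecMul_vecMul, ih]
    by_cases h : a ≠ 0 ∨ Nat.ofDigits B l ≠ 0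
    · rw [Nat.digits_add B hB a _ (hl a List.mem_cons_self) h]
      simp [← vecMul_vecMul]
    · push Not at h
      simp [h, hzero]

/-- Reversing a word turns its value as a `B`-ary fraction into a scaled `B`-ary integer. -/
theorem sum_rev_div_pow_eq {B M : ℕ} (hB : B ≠ 0) (f : Fin M → Fin B) :
    (∑ i : Fin M, ((f i.rev : ℕ) : ℝ) / (B : ℝ) ^ ((i : ℕ) + 1)) =
      ((finFunctionFinEquiv f : ℕ) : ℝ) / (B : ℝ) ^ M := by
  have hB' : (B : ℝ) ≠ 0 := by exact_mod_cast hB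
  rw [finFunctionFinEquiv_apply, Nat.cast_sum, Finset.sum_div, ← Equiv.sum_comp Fin.revPerm]
  refine Finset.sum_congr rfl fun i _ => ?_
  have hpow : (B : ℝ) ^ M = (B : ℝ) ^ (i : ℕ) * (B : ℝ) ^ ((Fin.rev i : ℕ) + 1) := by
    rw [← pow_add, Fin.val_rev]
    congr 1
    omega
  rw [Fin.revPerm_apply, Fin.rev_rev, Nat.cast_mul, Nat.cast_pow, hpow]
  field_simp

/-- for a zero-insensitive linear representation of the backward
differences `u` of `s`, with `K = ⌊log_B N⌋` and `t = log_B N - K`, one has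
`s_N = S_{K+1}(B^(t-1))`. -/
theorem partial_sum_eq_truncated_series
    (B d : ℕ) (hB : 2 ≤ B)
    (L C : Fin d → ℂ) (A : ℕ → Matrix (Fin d) (Fin d) ℂ)
    (hzero : L ᵥ* A 0 = L)
    (u : ℕ → ℂ)
    (hu : ∀ n, u n = L ⬝ᵥ (((Nat.digits B n).reverse.map A).prod *ᵥ C))
    (s : ℕ → ℂ) (hs : ∀ N, s N = ∑ n ∈ Finset.range (N + 1), u n)
    (S : ℕ → ℝ → ℂ)
    (hS : ∀ K x, S K x =
      ∑ w ∈ Finset.univ.filter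
          (fun w : Fin K → Fin B =>
            (∑ i : Fin K, ((w i : ℕ) : ℝ) / (B : ℝ) ^ ((i : ℕ) + 1)) ≤ x),
        L ⬝ᵥ (((List.ofFn fun i => A (w i)).prod) *ᵥ C))
    (N : ℕ) (hN : 1 ≤ N)
    (K : ℕ) (hK : K = Nat.log B N)
    (t : ℝ) (ht : t = Real.logb B N - K) :
    s N = S (K + 1) ((B : ℝ) ^ (t - 1)) := by
  have hB0 : (0 : ℝ) < B := by exact_mod_cast (by omega : 0 < B)
  have hpow : (B : ℝ) ^ (t - 1) = N / (B : ℝ) ^ (K + 1) := by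
    have hexp : t - 1 = Real.logb B N - ((K + 1 : ℕ) : ℝ) := by
      rw [ht]; push_cast; ring
    rw [hexp, Real.rpow_sub hB0, Real.rpow_natCast,
      Real.rpow_logb hB0 (by exact_mod_cast (by omega : B ≠ 1)) (by exact_mod_cast hN)]
  have hNlt : N < B ^ (K + 1) := hK ▸ Nat.lt_pow_succ_log_self (by omega) N
  have hterm : ∀ f : Fin (K + 1) → Fin B,
      L ⬝ᵥ ((List.ofFn fun i => A (f (Fin.rev i))).prod *ᵥ C) =
        u (finFunctionFinEquiv f : ℕ) := by
    intro f
    have hrev : (List.ofFn fun i => A (f (Fin.rev i))) =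
        (List.ofFn fun i => (f i : ℕ)).reverse.map A := by
      rw [← ofFn_rev, List.map_ofFn]
      rfl
    rw [hu, hrev, dotProduct_mulVec, dotProduct_mulVec,
      vecMul_prod_eq_vecMul_prod_digits (B := B) (by omega) hzero _ (by simp [List.mem_ofFn]),
      ofDigits_ofFn_eq_sum, finFunctionFinEquiv_apply]
  rw [hs, hS, hpow, Finset.sum_filter,
    ← (Equiv.arrowCongr Fin.revPerm (Equiv.refl (Fin B))).sum_comp]
  have hsummand : ∀ f : Fin (K + 1) → Fin B,
      Equiv.arrowCongr Fin.revPerm (Equiv.refl (Fin B)) f = fun i => f (Fin.rev i) :=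
    fun _ => rfl
  simp only [hsummand, hterm, sum_rev_div_pow_eq (show B ≠ 0 by omega),
    div_le_div_iff_of_pos_right (pow_pos hB0 (K + 1)), Nat.cast_le]
  rw [finFunctionFinEquiv.sum_comp fun n : Fin (B ^ (K + 1)) => if (n : ℕ) ≤ N then u n else 0,
    Fin.sum_univ_eq_sum_range fun n => if n ≤ N then u n else 0, ← Finset.sum_filter]
  refine Finset.sum_congr ?_ fun _ _ => rfl
  ext n
  simp only [Finset.mem_range, Finset.mem_filter]
  omega
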